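/- arXiv:math/0007202 — 2 statements merged into one kernel-verified Lean document; each statement's English description precedes it below -/
import Mathlib

section
/- For every positive integer N there is a constant C > 0 depending only on N such that for every monic polynomial Q of degree N over ℂ there exists a root α of Q with L_i(α) ≤ C·L_i for all integers 0 ≤ i ≤ N/2 (and hence L_i ≤ L_i(α) ≤ C·L_i, since L_i ≤ L_i(α) always holds). -/
open Polynomial

/-- The local cluster scale `L_k(α)` of the root multiset `S` of `Q`. -/
noncomputable def clusterScale (Q : Polynomial ℂ) (k : ℕ) (α : ℂ) : ℝ :=
  sInf { d : ℝ | ∃ S' : Multiset ℂ, S' ≤ Q.roots ∧ S'.card = Q.natDegree - k ∧ α ∈ S' ∧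
    d = Metric.diam (↑S'.toFinset : Set ℂ) }

/-- The absolute cluster scale `L_k = min_{α ∈ S} L_k(α)`. -/
noncomputable def absClusterScale (Q : Polynomial ℂ) (k : ℕ) : ℝ :=
  sInf { d : ℝ | ∃ α ∈ Q.roots, d = clusterScale Q k α }

lemma Multiset.exists_le_card_eq_of_le_card {α : Type*} {s : Multiset α} {n : ℕ}
    (h : n ≤ s.card) : ∃ t ≤ s, t.card = n := by
  have hpos : 0 < (s.powersetCard n).card := by
    rw [Multiset.card_powersetCard]
    exact Nat.choose_pos h
  obtain ⟨t, ht⟩ := Multiset.card_pos_iff_exists_mem.1 hpos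
  exact ⟨t, Multiset.mem_powersetCard.1 ht⟩

lemma finite_clusterScale_set (Q : ℂ[X]) (k : ℕ) (α : ℂ) :
    { d : ℝ | ∃ S' : Multiset ℂ, S' ≤ Q.roots ∧ S'.card = Q.natDegree - k ∧ α ∈ S' ∧
      d = Metric.diam (↑S'.toFinset : Set ℂ) }.Finite := by
  refine ((Set.finite_Iic Q.roots).image
    fun S' : Multiset ℂ => Metric.diam (↑S'.toFinset : Set ℂ)).subset ?_
  rintro d ⟨S', hS', -, -, rfl⟩
  exact ⟨S', hS', rfl⟩

lemma finite_absClusterScale_set (Q : ℂ[X]) (k : ℕ) :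
    { d : ℝ | ∃ α ∈ Q.roots, d = clusterScale Q k α }.Finite := by
  refine (Q.roots.toFinset.finite_toSet.image (clusterScale Q k)).subset ?_
  rintro d ⟨α, hα, rfl⟩
  exact ⟨α, by simpa only [Finset.mem_coe, Multiset.mem_toFinset] using hα, rfl⟩

lemma clusterScale_le_diam {Q : ℂ[X]} {k : ℕ} {α : ℂ} {S' : Multiset ℂ} (hS' : S' ≤ Q.roots)
    (hcard : S'.card = Q.natDegree - k) (hα : α ∈ S') :
    clusterScale Q k α ≤ Metric.diam (↑S'.toFinset : Set ℂ) :=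
  csInf_le (finite_clusterScale_set Q k α).bddBelow ⟨S', hS', hcard, hα, rfl⟩

lemma absClusterScale_le_clusterScale {Q : ℂ[X]} (k : ℕ) {α : ℂ} (hα : α ∈ Q.roots) :
    absClusterScale Q k ≤ clusterScale Q k α :=
  csInf_le (finite_absClusterScale_set Q k).bddBelow ⟨α, hα, rfl⟩

lemma exists_le_roots_card_eq_mem {Q : ℂ[X]} {k : ℕ} (hk : k < Q.natDegree) {α : ℂ}
    (hα : α ∈ Q.roots) : ∃ S' ≤ Q.roots, S'.card = Q.natDegree - k ∧ α ∈ S' := by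
  have hroots : Q.roots.card = Q.natDegree := IsAlgClosed.card_roots_eq_natDegree
  have hle : Q.natDegree - k - 1 ≤ (Q.roots.erase α).card := by
    rw [Multiset.card_erase_of_mem hα, hroots, Nat.pred_eq_sub_one]
    lia
  obtain ⟨T, hT, hTcard⟩ := Multiset.exists_le_card_eq_of_le_card hle
  refine ⟨α ::ₘ T, ?_, ?_, Multiset.mem_cons_self α T⟩
  · rw [← Multiset.cons_erase hα]
    exact Multiset.cons_le_cons α hT
  · rw [Multiset.card_cons, hTcard]
    lia

/-- The absolute cluster scale is attained by a sub-multiset of the roots. -/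
lemma exists_diam_eq_absClusterScale {Q : ℂ[X]} {k : ℕ} (hk : k < Q.natDegree) :
    ∃ S' ≤ Q.roots, S'.card = Q.natDegree - k ∧
      Metric.diam (↑S'.toFinset : Set ℂ) = absClusterScale Q k := by
  have hroots : Q.roots.card = Q.natDegree := IsAlgClosed.card_roots_eq_natDegree
  obtain ⟨β, hβ⟩ := Multiset.card_pos_iff_exists_mem.1 (hroots ▸ (Nat.zero_le k).trans_lt hk)
  obtain ⟨α, hα, hαk⟩ :=
    (show { d : ℝ | ∃ α ∈ Q.roots, d = clusterScale Q k α }.Nonempty from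
      ⟨_, β, hβ, rfl⟩).csInf_mem (finite_absClusterScale_set Q k)
  obtain ⟨T, hT, hTcard, hαT⟩ := exists_le_roots_card_eq_mem hk hα
  obtain ⟨S', hS', hcard, -, hd⟩ :=
    (show { d : ℝ | ∃ S' : Multiset ℂ, S' ≤ Q.roots ∧ S'.card = Q.natDegree - k ∧ α ∈ S' ∧
        d = Metric.diam (↑S'.toFinset : Set ℂ) }.Nonempty from
      ⟨_, T, hT, hTcard, hαT, rfl⟩).csInf_mem (finite_clusterScale_set Q k α)
  exact ⟨S', hS', hcard, hd.symm.trans hαk.symm⟩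

lemma absClusterScale_anti {Q : ℂ[X]} {i m : ℕ} (him : i ≤ m) (hm : m < Q.natDegree) :
    absClusterScale Q m ≤ absClusterScale Q i := by
  obtain ⟨S', hS', hcard, hd⟩ := exists_diam_eq_absClusterScale (him.trans_lt hm)
  obtain ⟨T, hT, hTcard⟩ :=
    Multiset.exists_le_card_eq_of_le_card (show Q.natDegree - m ≤ S'.card by lia)
  obtain ⟨α, hα⟩ := Multiset.card_pos_iff_exists_mem.1 (show 0 < T.card by lia)
  have hTQ := hT.trans hS'
  rw [← hd]
  exact (absClusterScale_le_clusterScale m (Multiset.mem_of_le hTQ hα)).trans <|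
    (clusterScale_le_diam hTQ hTcard hα).trans <|
    Metric.diam_mono (Finset.coe_subset.2 (Multiset.toFinset_subset.2 (Multiset.subset_of_le hT)))
      S'.toFinset.finite_toSet.isBounded

lemma Multiset.exists_mem_mem_of_card_lt {α : Type*} [DecidableEq α] {s t u : Multiset α}
    (hs : s ≤ u) (ht : t ≤ u) (h : u.card < s.card + t.card) : ∃ a, a ∈ s ∧ a ∈ t := by
  by_contra! hdisj
  have hle : s + t ≤ u := by
    rw [Multiset.add_eq_union_iff_disjoint.2 (Multiset.disjoint_left.2 fun {a} => hdisj a)]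
    exact Multiset.union_le hs ht
  have := Multiset.card_le_card hle
  rw [Multiset.card_add] at this
  lia

lemma clusterScale_le_of_forall_dist_le {Q : ℂ[X]} {k : ℕ} {α : ℂ} {S' : Multiset ℂ} {d : ℝ}
    (hk : k < Q.natDegree) (hα : α ∈ Q.roots) (hS' : S' ≤ Q.roots)
    (hcard : S'.card = Q.natDegree - k) (hd : Metric.diam (↑S'.toFinset : Set ℂ) ≤ d)
    (hdist : ∀ x ∈ S', dist α x ≤ d) : clusterScale Q k α ≤ d := by
  by_cases hαS : α ∈ S'
  · exact (clusterScale_le_diam hS' hcard hαS).trans hd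
  obtain ⟨β, hβ⟩ := Multiset.card_pos_iff_exists_mem.1 (show 0 < S'.card by lia)
  have hle : α ::ₘ S'.erase β ≤ Q.roots :=
    (Multiset.cons_le_of_notMem fun h => hαS (Multiset.mem_of_mem_erase h)).2
      ⟨hα, (Multiset.erase_le β S').trans hS'⟩
  have hc : (α ::ₘ S'.erase β).card = Q.natDegree - k := by
    rw [Multiset.card_cons, Multiset.card_erase_add_one hβ, hcard]
  refine (clusterScale_le_diam hle hc (Multiset.mem_cons_self _ _)).trans ?_
  have hd0 : 0 ≤ d := Metric.diam_nonneg.trans hd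
  refine Metric.diam_le_of_forall_dist_le hd0 fun x hx y hy => ?_
  rw [Finset.mem_coe, Multiset.mem_toFinset, Multiset.mem_cons] at hx hy
  rcases hx with rfl | hx <;> rcases hy with rfl | hy
  · rwa [dist_self]
  · exact hdist y (Multiset.mem_of_mem_erase hy)
  · rw [dist_comm]
    exact hdist x (Multiset.mem_of_mem_erase hx)
  · exact (Metric.dist_le_diam_of_mem S'.toFinset.finite_toSet.isBounded
      (Multiset.mem_toFinset.2 (Multiset.mem_of_mem_erase hx))
      (Multiset.mem_toFinset.2 (Multiset.mem_of_mem_erase hy))).trans hd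

/-- Theorem 2 (i): there is a root `α` with `L_i(α) ∼ L_i` for all `0 ≤ i ≤ N/2`. -/
theorem stmt1 (N : ℕ) (hN : 0 < N) :
    ∃ C : ℝ, 0 < C ∧
      ∀ Q : Polynomial ℂ, Q.Monic → Q.natDegree = N →
        ∃ α ∈ Q.roots, ∀ i : ℕ, 2 * i ≤ N →
          clusterScale Q i α ≤ C * absClusterScale Q i := by
  refine ⟨2, two_pos, fun Q _ hQN => ?_⟩
  subst hQN
  have hroots : Q.roots.card = Q.natDegree := IsAlgClosed.card_roots_eq_natDegree
  set m := Q.natDegree / 2 with hm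
  have hmN : m < Q.natDegree := by lia
  obtain ⟨A, hA, hAcard, hAd⟩ := exists_diam_eq_absClusterScale hmN
  obtain ⟨α, hα⟩ := Multiset.card_pos_iff_exists_mem.1 (show 0 < A.card by lia)
  have hαQ := Multiset.mem_of_le hA hα
  refine ⟨α, hαQ, fun i hi => ?_⟩
  rcases (show i ≤ m by lia).eq_or_lt with rfl | him
  · have hle := clusterScale_le_diam hA hAcard hα
    have h0 : 0 ≤ Metric.diam (↑A.toFinset : Set ℂ) := Metric.diam_nonneg
    linarith
  obtain ⟨B, hB, hBcard, hBd⟩ := exists_diam_eq_absClusterScale (him.trans hmN)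
  obtain ⟨β, hβA, hβB⟩ := Multiset.exists_mem_mem_of_card_lt hA hB (by lia)
  have hanti := absClusterScale_anti him.le hmN
  have h0 : 0 ≤ Metric.diam (↑B.toFinset : Set ℂ) := Metric.diam_nonneg
  refine clusterScale_le_of_forall_dist_le (him.trans hmN) hαQ hB hBcard (by linarith)
    fun x hx => ?_
  have h1 := Metric.dist_le_diam_of_mem A.toFinset.finite_toSet.isBounded
    (Multiset.mem_toFinset.2 hα) (Multiset.mem_toFinset.2 hβA)
  have h2 := Metric.dist_le_diam_of_mem B.toFinset.finite_toSet.isBounded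
    (Multiset.mem_toFinset.2 hβB) (Multiset.mem_toFinset.2 hx)
  linarith [dist_triangle α β x]
end

section
/- Let p, δ ≥ 0 be real, N a positive integer, and c ∈ (0,1), and assume p − (N−k)δ ≠ 0 for all integers 0 ≤ k ≤ N. Then there exist constants c_1, C_1 > 0 depending only on c, p, N, δ such that for all real numbers Λ > 0 and L_0 ≥ L_1 ≥ … ≥ L_{N−2} ≥ L_{N−1} = 0 with cΛ ≥ L_0, the quantity I = ∫_0^Λ r^p / ∏_{i=0}^{N−1} (r + L_i)^δ · dr/r satisfies c_1·E ≤ I ≤ C_1·E, where E = Λ^{p−Nδ} if p > Nδ, and E = [ L_k^{(N−k)δ−p} · ∏_{0≤i<k} L_i^δ ]^{−1} if (N−k−1)δ < p < (N−k)δ for the (unique) integer 0 ≤ k ≤ N−1; here both I and E lie in (0,∞] and I is finite if and only if E is finite (with the convention 0^t = 0 for t > 0). -/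
open MeasureTheory

lemma lintegral_Ioc_rpow_sub_one {s t : ℝ} (hs : 0 < s) (ht : 0 < t) :
    ∫⁻ r in Set.Ioc 0 t, ENNReal.ofReal (r ^ (s - 1)) = ENNReal.ofReal (t ^ s / s) := by
  have hi : IntegrableOn (fun r : ℝ => r ^ (s - 1)) (Set.Ioc 0 t) :=
    (intervalIntegrable_iff_integrableOn_Ioc_of_le ht.le).1
      (intervalIntegral.intervalIntegrable_rpow' (by linarith))
  rw [← ofReal_integral_eq_lintegral_ofReal hi
      ((ae_restrict_mem measurableSet_Ioc).mono fun r hr => Real.rpow_nonneg hr.1.le _),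
    ← intervalIntegral.integral_of_le ht.le, integral_rpow (Or.inl (by linarith))]
  simp [Real.zero_rpow hs.ne']

lemma lintegral_Ioi_rpow_sub_one {s t : ℝ} (hs : s < 0) (ht : 0 < t) :
    ∫⁻ r in Set.Ioi t, ENNReal.ofReal (r ^ (s - 1)) = ENNReal.ofReal (t ^ s / -s) := by
  rw [← ofReal_integral_eq_lintegral_ofReal (integrableOn_Ioi_rpow_of_lt (by linarith) ht)
      ((ae_restrict_mem measurableSet_Ioi).mono fun r hr => Real.rpow_nonneg (ht.trans hr).le _),
    integral_Ioi_rpow_of_lt (by linarith) ht]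
  simp [neg_div, div_neg]

lemma lintegral_Ioo_rpow_sub_one_eq_top {s t : ℝ} (hs : s ≤ 0) (ht : 0 < t) :
    ∫⁻ r in Set.Ioo 0 t, ENNReal.ofReal (r ^ (s - 1)) = ⊤ := by
  by_contra h
  have hm : Measurable fun r : ℝ => r ^ (s - 1) := by fun_prop
  have hi : IntegrableOn (fun r : ℝ => r ^ (s - 1)) (Set.Ioo 0 t) := by
    refine ⟨hm.aestronglyMeasurable, ?_⟩
    rw [hasFiniteIntegral_iff_ofReal
      ((ae_restrict_mem measurableSet_Ioo).mono fun r hr => Real.rpow_nonneg hr.1.le _)]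
    exact lt_top_iff_ne_top.2 h
  rw [intervalIntegral.integrableOn_Ioo_rpow_iff ht] at hi
  linarith

lemma setLIntegral_const_mul_rpow {S : Set ℝ} {A s : ℝ} (hA : 0 ≤ A) :
    ∫⁻ r in S, ENNReal.ofReal (A * r ^ (s - 1)) =
      ENNReal.ofReal A * ∫⁻ r in S, ENNReal.ofReal (r ^ (s - 1)) := by
  rw [← lintegral_const_mul _ (by fun_prop)]
  simp_rw [ENNReal.ofReal_mul hA]

lemma prod_rpow_add_ge {L : ℕ → ℝ} {N m : ℕ} {δ r : ℝ} (hδ : 0 ≤ δ) (hr : 0 < r)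
    (hL : ∀ i < N, 0 ≤ L i) (hm : m ≤ N) :
    (∏ i ∈ Finset.range m, L i ^ δ) * r ^ (((N : ℝ) - m) * δ) ≤
      ∏ i ∈ Finset.range N, (r + L i) ^ δ := by
  rw [← Finset.prod_range_mul_prod_Ico _ hm]
  have hp : r ^ (((N : ℝ) - m) * δ) = ∏ i ∈ Finset.Ico m N, r ^ δ := by
    rw [Finset.prod_const, Nat.card_Ico, ← Real.rpow_natCast, ← Real.rpow_mul hr.le,
      Nat.cast_sub hm, mul_comm]
  rw [hp]
  have hL' : ∀ i ∈ Finset.range m, 0 ≤ L i := fun i hi =>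
    hL i ((Finset.mem_range.1 hi).trans_le hm)
  gcongr with i hi i hi
  · exact Finset.prod_nonneg fun i hi => Real.rpow_nonneg (by linarith [hL' i hi]) _
  · exact fun i hi => Real.rpow_nonneg (hL' i hi) _
  · exact hL' i hi
  · linarith
  · linarith [hL i (Finset.mem_Ico.1 hi).2]

lemma prod_rpow_add_le {L y : ℕ → ℝ} {N m : ℕ} {δ r x : ℝ} (hδ : 0 ≤ δ) (hr : 0 < r)
    (hL : ∀ i < N, 0 ≤ L i) (hm : m ≤ N) (hy : ∀ i < m, r ≤ y i ∧ L i ≤ y i)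
    (hx : r ≤ x) (hLx : ∀ i < N, m ≤ i → L i ≤ x) :
    ∏ i ∈ Finset.range N, (r + L i) ^ δ ≤
      2 ^ (N * δ) * ((∏ i ∈ Finset.range m, y i ^ δ) * x ^ (((N : ℝ) - m) * δ)) := by
  have hx0 : 0 ≤ x := hr.le.trans hx
  have hy0 : ∀ i ∈ Finset.range m, 0 ≤ y i := fun i hi =>
    hr.le.trans (hy i (Finset.mem_range.1 hi)).1
  have hp : x ^ (((N : ℝ) - m) * δ) = ∏ i ∈ Finset.Ico m N, x ^ δ := by
    rw [Finset.prod_const, Nat.card_Ico, ← Real.rpow_natCast, ← Real.rpow_mul hx0,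
      Nat.cast_sub hm, mul_comm]
  have h2 : (2 : ℝ) ^ (N * δ) =
      (∏ i ∈ Finset.range m, (2 : ℝ) ^ δ) * ∏ i ∈ Finset.Ico m N, (2 : ℝ) ^ δ := by
    rw [Finset.prod_range_mul_prod_Ico _ hm, Finset.prod_const, Finset.card_range,
      ← Real.rpow_natCast, ← Real.rpow_mul zero_le_two, mul_comm]
  rw [hp, h2, mul_mul_mul_comm, ← Finset.prod_mul_distrib, ← Finset.prod_mul_distrib,
    ← Finset.prod_range_mul_prod_Ico _ hm]
  have hnn : ∀ i < N, 0 ≤ (r + L i) ^ δ := fun i hi =>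
    Real.rpow_nonneg (by linarith [hL i hi]) _
  have h₁ : ∏ i ∈ Finset.range m, (r + L i) ^ δ ≤ ∏ i ∈ Finset.range m, 2 ^ δ * y i ^ δ := by
    refine Finset.prod_le_prod (fun i hi => hnn i ((Finset.mem_range.1 hi).trans_le hm))
      fun i hi => ?_
    have hi' := Finset.mem_range.1 hi
    rw [← Real.mul_rpow zero_le_two (hy0 i hi)]
    exact Real.rpow_le_rpow (by linarith [hL i (hi'.trans_le hm)])
      (by linarith [hy i hi']) hδ
  have h₂ : ∏ i ∈ Finset.Ico m N, (r + L i) ^ δ ≤ ∏ i ∈ Finset.Ico m N, 2 ^ δ * x ^ δ := by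
    refine Finset.prod_le_prod (fun i hi => hnn i (Finset.mem_Ico.1 hi).2) fun i hi => ?_
    have hi' := Finset.mem_Ico.1 hi
    rw [← Real.mul_rpow zero_le_two hx0]
    exact Real.rpow_le_rpow (by linarith [hL i hi'.2]) (by linarith [hLx i hi'.2 hi'.1]) hδ
  exact mul_le_mul h₁ h₂ (Finset.prod_nonneg fun i hi => hnn i (Finset.mem_Ico.1 hi).2)
    (Finset.prod_nonneg fun i hi => mul_nonneg (by positivity) (Real.rpow_nonneg (hy0 i hi) _))

/-- The integrand is at most the power of `r` obtained by keeping `L i` for `i < m` and `r` for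
`i ≥ m` in each factor `r + L i`. -/
lemma integrand_le {L : ℕ → ℝ} {N m : ℕ} {p δ r : ℝ} (hδ : 0 ≤ δ) (hr : 0 < r)
    (hL : ∀ i < N, 0 ≤ L i) (hm : m ≤ N) (hpos : ∀ i < m, 0 < L i) :
    (r ^ p / ∏ i ∈ Finset.range N, (r + L i) ^ δ) * r⁻¹ ≤
      (∏ i ∈ Finset.range m, L i ^ δ)⁻¹ * r ^ (p - ((N : ℝ) - m) * δ - 1) := by
  have hP : 0 < ∏ i ∈ Finset.range m, L i ^ δ :=
    Finset.prod_pos fun i hi => Real.rpow_pos_of_pos (hpos i (Finset.mem_range.1 hi)) _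
  have hQ : 0 < r ^ (((N : ℝ) - m) * δ) := Real.rpow_pos_of_pos hr _
  calc (r ^ p / ∏ i ∈ Finset.range N, (r + L i) ^ δ) * r⁻¹
      ≤ (r ^ p / ((∏ i ∈ Finset.range m, L i ^ δ) * r ^ (((N : ℝ) - m) * δ))) * r⁻¹ := by
        gcongr
        exact prod_rpow_add_ge hδ hr hL hm
    _ = _ := by
        rw [Real.rpow_sub_one hr.ne', Real.rpow_sub hr]
        field_simp

/-- A lower bound for the integrand from upper bounds `y i` (for `i < m`) and `x` (for `i ≥ m`)
of both `r` and `L i`. -/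
lemma le_integrand {L y : ℕ → ℝ} {N m : ℕ} {p δ r x : ℝ} (hδ : 0 ≤ δ) (hr : 0 < r)
    (hL : ∀ i < N, 0 ≤ L i) (hm : m ≤ N) (hy : ∀ i < m, r ≤ y i ∧ L i ≤ y i)
    (hx : r ≤ x) (hLx : ∀ i < N, m ≤ i → L i ≤ x) :
    (2 ^ (N * δ) * ((∏ i ∈ Finset.range m, y i ^ δ) * x ^ (((N : ℝ) - m) * δ)))⁻¹ *
        r ^ (p - 1) ≤
      (r ^ p / ∏ i ∈ Finset.range N, (r + L i) ^ δ) * r⁻¹ := by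
  have hP : 0 < ∏ i ∈ Finset.range N, (r + L i) ^ δ :=
    Finset.prod_pos fun i hi =>
      Real.rpow_pos_of_pos (by linarith [hL i (Finset.mem_range.1 hi)]) _
  calc _ ≤ (∏ i ∈ Finset.range N, (r + L i) ^ δ)⁻¹ * r ^ (p - 1) := by
        gcongr
        exact prod_rpow_add_le hδ hr hL hm hy hx hLx
    _ = _ := by
        rw [Real.rpow_sub_one hr.ne']
        ring

/-- Lemma 2.2: size of `∫_0^Λ r^p / ∏_{i=0}^{N-1}(r+L_i)^δ · dr/r` for decreasing
cluster scales `cΛ ≥ L_0 ≥ ⋯ ≥ L_{N-1} = 0`. -/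
theorem stmt10 (p δ : ℝ) (hp : 0 ≤ p) (hδ : 0 ≤ δ) (N : ℕ) (hN : 0 < N)
    (c : ℝ) (hc0 : 0 < c) (hc1 : c < 1)
    (hnd : ∀ k : ℕ, k ≤ N → p - ((N : ℝ) - (k : ℝ)) * δ ≠ 0) :
    ∃ c₁ C₁ : ℝ, 0 < c₁ ∧ 0 < C₁ ∧
      ∀ (Λ : ℝ) (L : ℕ → ℝ), 0 < Λ →
        (∀ i : ℕ, i + 1 ≤ N - 1 → L (i + 1) ≤ L i) → L (N - 1) = 0 → L 0 ≤ c * Λ →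
        (((N : ℝ) * δ < p →
            ENNReal.ofReal c₁ * ENNReal.ofReal (Λ ^ (p - (N : ℝ) * δ)) ≤
                (∫⁻ r in Set.Ioo (0 : ℝ) Λ,
                  ENNReal.ofReal
                    ((r ^ p / ∏ i ∈ Finset.range N, (r + L i) ^ δ) * r⁻¹)) ∧
              (∫⁻ r in Set.Ioo (0 : ℝ) Λ,
                  ENNReal.ofReal
                    ((r ^ p / ∏ i ∈ Finset.range N, (r + L i) ^ δ) * r⁻¹)) ≤
                ENNReal.ofReal C₁ * ENNReal.ofReal (Λ ^ (p - (N : ℝ) * δ))) ∧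
          (∀ k : ℕ, k < N → ((N : ℝ) - (k : ℝ) - 1) * δ < p → p < ((N : ℝ) - (k : ℝ)) * δ →
            ENNReal.ofReal c₁ *
                (ENNReal.ofReal
                  (L k ^ (((N : ℝ) - (k : ℝ)) * δ - p) *
                    ∏ i ∈ Finset.range k, L i ^ δ))⁻¹ ≤
                (∫⁻ r in Set.Ioo (0 : ℝ) Λ,
                  ENNReal.ofReal
                    ((r ^ p / ∏ i ∈ Finset.range N, (r + L i) ^ δ) * r⁻¹)) ∧
              (∫⁻ r in Set.Ioo (0 : ℝ) Λ,
                  ENNReal.ofReal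
                    ((r ^ p / ∏ i ∈ Finset.range N, (r + L i) ^ δ) * r⁻¹)) ≤
                ENNReal.ofReal C₁ *
                  (ENNReal.ofReal
                    (L k ^ (((N : ℝ) - (k : ℝ)) * δ - p) *
                      ∏ i ∈ Finset.range k, L i ^ δ))⁻¹)) := by
  have hp0 : 0 < p := lt_of_le_of_ne hp fun h => hnd N le_rfl (by simp [← h])
  set T : ℝ := ∑ k ∈ Finset.range (N + 1), |p - ((N : ℝ) - k) * δ|⁻¹
  have hTk : ∀ k ≤ N, |p - ((N : ℝ) - k) * δ|⁻¹ ≤ T := fun k hk =>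
    Finset.single_le_sum (f := fun k : ℕ => |p - ((N : ℝ) - k) * δ|⁻¹)
      (fun i _ => inv_nonneg.2 (abs_nonneg _)) (Finset.mem_range.2 (by omega))
  have hT0 : 0 < T := (inv_pos.2 (abs_pos.2 (hnd 0 (Nat.zero_le _)))).trans_le
    (hTk 0 (Nat.zero_le _))
  have h2 : (0 : ℝ) < 2 ^ (N * δ) := Real.rpow_pos_of_pos two_pos _
  refine ⟨(2 ^ (N * δ))⁻¹ / p, 2 * T, by positivity, by positivity, ?_⟩
  intro Λ L hΛ hstep hlast hL0
  have hanti : ∀ i j, i ≤ j → j < N → L j ≤ L i := by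
    intro i j hij
    induction j, hij using Nat.le_induction with
    | base => exact fun _ => le_rfl
    | succ j _ ih => exact fun hj => (hstep j (by omega)).trans (ih (by omega))
  have hL : ∀ i < N, 0 ≤ L i := fun i hi => hlast ▸ hanti i (N - 1) (by omega) (by omega)
  have hLΛ : ∀ i < N, L i < Λ := fun i hi =>
    ((hanti 0 i (Nat.zero_le _) hi).trans hL0).trans_lt (by nlinarith)
  refine ⟨fun hpN => ?_, fun k hk hlo hhi => ?_⟩
  · have hs : 0 < p - N * δ := by linarith
    rw [setLIntegral_congr Ioo_ae_eq_Ioc]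
    constructor
    · calc _ = ∫⁻ r in Set.Ioc 0 Λ, ENNReal.ofReal
              ((2 ^ (N * δ) * Λ ^ (N * δ))⁻¹ * r ^ (p - 1)) := by
            rw [setLIntegral_const_mul_rpow (by positivity), lintegral_Ioc_rpow_sub_one hp0 hΛ,
              ← ENNReal.ofReal_mul (by positivity), ← ENNReal.ofReal_mul (by positivity),
              Real.rpow_sub hΛ]
            congr 1
            field_simp
        _ ≤ _ := by
            refine setLIntegral_mono' measurableSet_Ioc fun r hr => ENNReal.ofReal_le_ofReal ?_
            simpa using le_integrand (y := fun _ => Λ) (m := 0) (p := p) hδ hr.1 hL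
              (Nat.zero_le _) (by simp) hr.2 fun i hi _ => (hLΛ i hi).le
    · calc _ ≤ ∫⁻ r in Set.Ioc 0 Λ, ENNReal.ofReal (r ^ (p - N * δ - 1)) := by
            refine setLIntegral_mono' measurableSet_Ioc fun r hr => ENNReal.ofReal_le_ofReal ?_
            simpa using integrand_le (m := 0) (p := p) hδ hr.1 hL (Nat.zero_le _) (by simp)
        _ ≤ _ := by
            rw [lintegral_Ioc_rpow_sub_one hs hΛ, ← ENNReal.ofReal_mul (by positivity)]
            refine ENNReal.ofReal_le_ofReal ?_
            have h := hTk 0 (Nat.zero_le _)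
            rw [Nat.cast_zero, sub_zero, abs_of_pos hs] at h
            rw [div_eq_inv_mul]
            gcongr
            linarith
  rcases (hL k hk).eq_or_lt with h0 | hpos
  · have htop : (∫⁻ r in Set.Ioo (0 : ℝ) Λ, ENNReal.ofReal
        ((r ^ p / ∏ i ∈ Finset.range N, (r + L i) ^ δ) * r⁻¹)) = ⊤ := by
      have hA : 0 < (2 ^ (N * δ) * ∏ i ∈ Finset.range k, Λ ^ δ)⁻¹ := by positivity
      have hz : ∀ r ∈ Set.Ioo 0 Λ, (2 ^ (N * δ) * ∏ i ∈ Finset.range k, Λ ^ δ)⁻¹ *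
          r ^ (p - ((N : ℝ) - k) * δ - 1) ≤
            (r ^ p / ∏ i ∈ Finset.range N, (r + L i) ^ δ) * r⁻¹ := by
        intro r hr
        refine le_trans (le_of_eq ?_) (le_integrand (y := fun _ => Λ) (x := r) (m := k) hδ hr.1 hL
          hk.le (fun i hi => ⟨hr.2.le, (hLΛ i (hi.trans hk)).le⟩) le_rfl
          fun i hi hki => (hanti k i hki hi).trans (h0 ▸ hr.1.le))
        have hr0 := hr.1
        rw [Real.rpow_sub_one hr.1.ne', Real.rpow_sub_one hr.1.ne', Real.rpow_sub hr.1]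
        field_simp
      refine top_unique (le_trans (le_of_eq ?_) (setLIntegral_mono' measurableSet_Ioo
        fun r hr => ENNReal.ofReal_le_ofReal (hz r hr)))
      rw [setLIntegral_const_mul_rpow hA.le,
        lintegral_Ioo_rpow_sub_one_eq_top (by linarith) hΛ, ENNReal.mul_top]
      simpa using hA
    have hE : L k ^ (((N : ℝ) - k) * δ - p) = 0 := by
      rw [← h0, Real.zero_rpow (by linarith)]
    rw [htop, hE, zero_mul, ENNReal.ofReal_zero, ENNReal.inv_zero,
      ENNReal.mul_top (ENNReal.ofReal_pos.2 (by positivity)).ne',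
      ENNReal.mul_top (ENNReal.ofReal_pos.2 (by positivity)).ne']
    exact ⟨le_rfl, le_rfl⟩
  have hLpos : ∀ i < k + 1, 0 < L i := fun i hi =>
    hpos.trans_le (hanti i k (by omega) hk)
  set P := ∏ i ∈ Finset.range k, L i ^ δ with hPdef
  have hP : 0 < P := Finset.prod_pos fun i hi =>
    Real.rpow_pos_of_pos (hLpos i (by have := Finset.mem_range.1 hi; omega)) _
  have hE : 0 < L k ^ (((N : ℝ) - k) * δ - p) := Real.rpow_pos_of_pos hpos _
  rw [← ENNReal.ofReal_inv_of_pos (by positivity)]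
  constructor
  · calc _ = ∫⁻ r in Set.Ioc 0 (L k), ENNReal.ofReal
            ((2 ^ (N * δ) * (P * L k ^ (((N : ℝ) - k) * δ)))⁻¹ * r ^ (p - 1)) := by
          rw [setLIntegral_const_mul_rpow (by positivity), lintegral_Ioc_rpow_sub_one hp0 hpos,
            ← ENNReal.ofReal_mul (by positivity), ← ENNReal.ofReal_mul (by positivity),
            Real.rpow_sub hpos]
          congr 1
          field_simp
      _ ≤ ∫⁻ r in Set.Ioc 0 (L k), ENNReal.ofReal
            ((r ^ p / ∏ i ∈ Finset.range N, (r + L i) ^ δ) * r⁻¹) := by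
          refine setLIntegral_mono' measurableSet_Ioc fun r hr => ENNReal.ofReal_le_ofReal ?_
          exact le_integrand hδ hr.1 hL hk.le
            (fun i hi => ⟨hr.2.trans (hanti i k hi.le hk), le_rfl⟩) hr.2
            fun i hi hki => hanti k i hki hi
      _ ≤ _ := lintegral_mono_set (Set.Ioc_subset_Ioo_right (hLΛ k hk))
  · have hb : 0 < p - ((N : ℝ) - ((k + 1 : ℕ) : ℝ)) * δ := by
      push_cast
      linarith
    have ha : p - ((N : ℝ) - k) * δ < 0 := by linarith
    have hTb := hTk (k + 1) hk
    have hTa := hTk k hk.le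
    rw [abs_of_pos hb] at hTb
    rw [abs_of_neg ha] at hTa
    have near : ∫⁻ r in Set.Ioc 0 (L k), ENNReal.ofReal
        ((r ^ p / ∏ i ∈ Finset.range N, (r + L i) ^ δ) * r⁻¹) ≤
          ENNReal.ofReal (T * (L k ^ (((N : ℝ) - k) * δ - p) * P)⁻¹) := by
      refine (setLIntegral_mono' measurableSet_Ioc fun r hr => ENNReal.ofReal_le_ofReal
        (integrand_le hδ hr.1 hL hk hLpos)).trans ?_
      rw [Finset.prod_range_succ, ← hPdef, setLIntegral_const_mul_rpow (by positivity),
        lintegral_Ioc_rpow_sub_one hb hpos, ← ENNReal.ofReal_mul (by positivity)]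
      refine ENNReal.ofReal_le_ofReal ?_
      calc _ = (p - ((N : ℝ) - ((k + 1 : ℕ) : ℝ)) * δ)⁻¹ *
            (L k ^ (((N : ℝ) - k) * δ - p) * P)⁻¹ := by
            have e : p - ((N : ℝ) - ((k + 1 : ℕ) : ℝ)) * δ =
              -(((N : ℝ) - k) * δ - p) + δ := by push_cast; ring
            rw [div_eq_inv_mul]
            nth_rw 2 [e]
            rw [Real.rpow_add hpos, Real.rpow_neg hpos.le]
            field_simp
        _ ≤ _ := by gcongr
    have far : ∫⁻ r in Set.Ioi (L k), ENNReal.ofReal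
        ((r ^ p / ∏ i ∈ Finset.range N, (r + L i) ^ δ) * r⁻¹) ≤
          ENNReal.ofReal (T * (L k ^ (((N : ℝ) - k) * δ - p) * P)⁻¹) := by
      refine (setLIntegral_mono' measurableSet_Ioi fun r hr => ENNReal.ofReal_le_ofReal
        (integrand_le hδ (hpos.trans hr) hL hk.le fun i hi => hLpos i (by omega))).trans ?_
      rw [← hPdef, setLIntegral_const_mul_rpow (by positivity),
        lintegral_Ioi_rpow_sub_one ha hpos, ← ENNReal.ofReal_mul (by positivity)]
      refine ENNReal.ofReal_le_ofReal ?_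
      calc _ = (-(p - ((N : ℝ) - k) * δ))⁻¹ * (L k ^ (((N : ℝ) - k) * δ - p) * P)⁻¹ := by
            rw [show ((N : ℝ) - k) * δ - p = -(p - ((N : ℝ) - k) * δ) by ring,
              Real.rpow_neg hpos.le, mul_inv, inv_inv]
            ring
        _ ≤ _ := by gcongr
    calc _ ≤ ∫⁻ r in Set.Ioc 0 (L k) ∪ Set.Ioi (L k), ENNReal.ofReal
            ((r ^ p / ∏ i ∈ Finset.range N, (r + L i) ^ δ) * r⁻¹) := by
          refine lintegral_mono_set fun r hr => ?_
          rw [Set.Ioc_union_Ioi_eq_Ioi hpos.le]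
          exact hr.1
      _ ≤ _ := (lintegral_union_le _ _ _).trans (add_le_add near far)
      _ = _ := by
          rw [← ENNReal.ofReal_add (by positivity) (by positivity),
            ← ENNReal.ofReal_mul (by positivity)]
          congr 1
          ring
end
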